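/- Suppose P is a d-dimensional k-template and X is an infinite set. Then the chromatic number χ(L(X^d,P)) is the least cardinal κ such that κ^{+(e(P)−1)} ≥ |X|. -/

import Mathlib

open Cardinal

universe u v

/-- `f` is one-to-one in each coordinate: if `a` and `b` differ in exactly one
coordinate, then `f a ≠ f b`. -/
def OneToOneEachCoord {d : ℕ} {X C : Type*} (f : (Fin d → X) → C) : Prop :=
  ∀ a b : Fin d → X, (∃ i, a i ≠ b i ∧ ∀ j, j ≠ i → a j = b j) → f a ≠ f b

/-- `Q` is a homomorphic image of the template `P`: there is a surjection of `P`
onto `Q` preserving coordinate equalities. -/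
def IsHomImage {d : ℕ} {α β : Type*} (P : Finset (Fin d → α)) (Q : Finset (Fin d → β)) : Prop :=
  ∃ f : (Fin d → α) → (Fin d → β),
    (∀ x ∈ P, f x ∈ Q) ∧ (∀ y ∈ Q, ∃ x ∈ P, f x = y) ∧
    (∀ x ∈ P, ∀ y ∈ P, ∀ i, x i = y i → f x i = f y i)

/-- The edge set of the template hypergraph `L(X^d, P)`: the edges are the
`k`-element subsets of `X^d` that are homomorphic images of `P`. -/
def LEdges (k : ℕ) {d : ℕ} {α : Type*} (P : Finset (Fin d → α)) (X : Type*) :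
    Set (Finset (Fin d → X)) :=
  {Q | Q.card = k ∧ IsHomImage P Q}

/-- Image of a finset (with classical decidable equality). -/
noncomputable def fimg {V W : Type*} (g : V → W) (e : Finset V) : Finset W :=
  @Finset.image _ _ (Classical.decEq W) g e

/-- `g` is an embedding of the hypergraph with edge set `E₁` into the one with
edge set `E₂`: an injection on vertices mapping every edge to an edge. -/
def IsHGEmbedding {V W : Type*} (E₁ : Set (Finset V)) (E₂ : Set (Finset W)) (g : V → W) : Prop :=
  Function.Injective g ∧ ∀ e ∈ E₁, fimg g e ∈ E₂

def Embeddable {V W : Type*} (E₁ : Set (Finset V)) (E₂ : Set (Finset W)) : Prop :=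
  ∃ g, IsHGEmbedding E₁ E₂ g

/-- The hypergraph with edge set `E` has a coloring with at most `κ` colors
that is not constant on any edge. -/
def ProperlyColorable {V : Type u} (E : Set (Finset V)) (κ : Cardinal.{u}) : Prop :=
  ∃ (C : Type u) (φ : V → C), #C ≤ κ ∧ ∀ e ∈ E, ∃ x ∈ e, ∃ y ∈ e, φ x ≠ φ y

/-- The chromatic number: the least `κ` admitting a proper `κ`-coloring. -/
noncomputable def chromaticNumber {V : Type u} (E : Set (Finset V)) : Cardinal.{u} :=
  sInf {κ | ProperlyColorable E κ}

/-- The edge set of the zero `k`-hypergraph of a `(k,n)`-ary real polynomial: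
the `k`-element subsets of `ℝ^n` admitting an enumeration on which `p` vanishes. -/
def zeroEdges (k n : ℕ) (p : MvPolynomial (Fin k × Fin n) ℝ) : Set (Finset (Fin n → ℝ)) :=
  {s | ∃ a : Fin k → (Fin n → ℝ), Function.Injective a ∧
        fimg a Finset.univ = s ∧ MvPolynomial.eval (fun v => a v.1 v.2) p = 0}

/-- `I` is a distinguisher for the template `P`: any two distinct elements of `P`
differ at some coordinate in `I`. -/
def IsDistinguisher {d : ℕ} {α : Type*} (P : Finset (Fin d → α)) (I : Finset (Fin d)) : Prop :=
  ∀ x ∈ P, ∀ y ∈ P, x ≠ y → ∃ i ∈ I, x i ≠ y i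

/-- `e(P)`: the least cardinality of a distinguisher for `P`. -/
noncomputable def eT {d : ℕ} {α : Type*} (P : Finset (Fin d → α)) : ℕ :=
  sInf {e | ∃ I : Finset (Fin d), IsDistinguisher P I ∧ I.card = e}

theorem Cardinal.le_iterate_succ (κ : Cardinal.{u}) (n : ℕ) : κ ≤ (Order.succ)^[n] κ :=
  Order.le_succ_iterate n κ

theorem Cardinal.iterate_succ_lt_aleph0 {κ : Cardinal.{u}} (hκ : κ < ℵ₀) (n : ℕ) :
    (Order.succ)^[n] κ < ℵ₀ := by
  induction n with
  | zero => exact hκ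
  | succ n ih =>
    rw [Function.iterate_succ_apply']
    exact Cardinal.isSuccLimit_aleph0.succ_lt ih

/-- Every finite set admits a map into a finite type that is injective on it. -/
theorem Set.Finite.exists_injOn_fin {α : Type v} {S : Set α} (hS : S.Finite) :
    ∃ (N : ℕ) (w : α → Fin N), Set.InjOn w S := by
  classical
  have := hS.to_subtype
  obtain ⟨N, ⟨e⟩⟩ := Finite.exists_equiv_fin (Option S)
  refine ⟨N, fun a => e (if h : a ∈ S then some ⟨a, h⟩ else none), fun a ha b hb hab => ?_⟩
  simpa [ha, hb] using hab

/-- If `#X ≤ μ⁺`, then `X` embeds into a linear order whose initial segments all inject into a set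
of size `μ`. -/
theorem exists_injOn_initial_segments {μ : Cardinal.{u}} (hμ : ℵ₀ ≤ μ)
    {X : Type u} (hX : #X ≤ Order.succ μ) :
    ∃ (T : Type u) (_ : LinearOrder T) (_ : X ↪ T) (h : T → T → μ.out),
      ∀ t, Set.InjOn (h t) (Set.Iic t) := by
  have hT : #(Order.succ μ).ord.ToType = Order.succ μ := mk_ord_toType _
  have hseg : ∀ t : (Order.succ μ).ord.ToType, ∃ f : (Order.succ μ).ord.ToType → μ.out,
      Set.InjOn f (Set.Iic t) := by
    intro t
    have hlt := mk_Iic_lt t (by simp) (by rw [hT]; exact hμ.trans (Order.le_succ μ))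
    rw [hT, Order.lt_succ_iff] at hlt
    obtain ⟨g⟩ : #(Set.Iic t) ≤ #μ.out := hlt.trans (mk_out μ).ge
    let f := Function.extend Subtype.val g fun _ => g ⟨t, Set.self_mem_Iic⟩
    refine ⟨f, fun a ha b hb hab => ?_⟩
    have key : ∀ c : Set.Iic t, f c = g c :=
      fun c => Subtype.val_injective.extend_apply _ _ c
    have := g.injective ((key ⟨a, ha⟩).symm.trans (hab.trans (key ⟨b, hb⟩)))
    exact congrArg Subtype.val this
  choose h hh using hseg
  rw [← hT] at hX
  obtain ⟨e⟩ := hX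
  exact ⟨_, inferInstance, e, h, hh⟩

/-- If `#X ≤ κ⁺⁽ⁿ⁾`, then `X^d` splits into `κ` classes, each of which is distinguished by at most
`n` coordinates. -/
theorem exists_coloring_distinguished (d : ℕ) {κ : Cardinal.{u}} (hκ : ℵ₀ ≤ κ) (n : ℕ) :
    ∀ {X : Type u}, #X ≤ (Order.succ)^[n] κ →
      ∃ (C : Type u) (φ : (Fin d → X) → C), #C ≤ κ ∧
        ∀ c, ∃ I : Finset (Fin d), I.card ≤ n ∧
          ∀ x y, φ x = c → φ y = c → (∀ i ∈ I, x i = y i) → x = y := by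
  induction n with
  | zero =>
    intro X hX
    refine ⟨Fin d → X, id, ?_, fun c => ⟨∅, by simp, ?_⟩⟩
    · have : #(Fin d → X) = #X ^ d := by simp
      rw [this]
      exact (pow_le_pow_left' hX d).trans (power_nat_le hκ)
    · rintro x y rfl hy -
      exact hy.symm
  | succ n ih =>
    intro X hX
    rcases isEmpty_or_nonempty (Fin d) with hd | hd
    · refine ⟨PUnit, fun _ => PUnit.unit, ?_, fun c => ⟨∅, by simp, ?_⟩⟩
      · rw [mk_punit]
        exact one_le_aleph0.trans hκ
      · intro x y _ _ _
        exact Subsingleton.elim _ _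
    rw [Function.iterate_succ_apply'] at hX
    obtain ⟨T, _, e, h, hh⟩ :=
      exists_injOn_initial_segments (hκ.trans (Cardinal.le_iterate_succ κ n)) hX
    obtain ⟨C, φ, hC, hφ⟩ := ih (mk_out ((Order.succ)^[n] κ)).le
    choose m hm using fun x : Fin d → X => Finite.exists_max fun i => e (x i)
    refine ⟨Fin d × C, fun x => (m x, φ fun i => h (e (x (m x))) (e (x i))), ?_, ?_⟩
    · rw [mk_prod]
      simp only [mk_fin, lift_natCast, lift_uzero]
      exact (mul_le_mul' (natCast_le_aleph0.trans hκ) hC).trans (mul_eq_self hκ).le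
    · rintro ⟨j, c⟩
      obtain ⟨I, hI, hIφ⟩ := hφ c
      refine ⟨insert j I, (Finset.card_insert_le j I).trans (by omega), fun x y hx hy hxy => ?_⟩
      obtain ⟨hxj, hxc⟩ := Prod.mk.inj hx
      obtain ⟨hyj, hyc⟩ := Prod.mk.inj hy
      have hj : x j = y j := hxy j (Finset.mem_insert_self j I)
      have hcode := hIφ _ _ hxc hyc fun i hi => by
        rw [hxj, hyj, hj, hxy i (Finset.mem_insert_of_mem hi)]
      funext i
      have hi := congrFun hcode i
      simp only [hxj, hyj, hj] at hi
      refine e.injective (hh (e (y j)) ?_ ?_ hi)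
      · have := hm x i
        rwa [hxj, hj] at this
      · have := hm y i
        rwa [hyj] at this

/-- A polarized partition relation: if `#X ≥ κ⁺⁽ᵐ⁾`, every coloring of `X^m` with `κ` colors has
monochromatic finite grids of every size. -/
theorem exists_monochromatic_grid {κ : Cardinal.{u}} (hκ : ℵ₀ ≤ κ) (N m : ℕ) {C : Type u}
    (hC : #C ≤ κ) :
    ∀ {X : Type u}, (Order.succ)^[m] κ ≤ #X → ∀ φ : (Fin m → X) → C,
      ∃ (g : Fin m → Fin N → X) (c : C), (∀ i, Function.Injective (g i)) ∧
        ∀ p : Fin m → Fin N, φ (fun i => g i (p i)) = c := by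
  induction m with
  | zero =>
    intro X _ φ
    exact ⟨fun i => i.elim0, φ fun i => i.elim0, fun i => i.elim0,
      fun p => congrArg φ (Subsingleton.elim _ _)⟩
  | succ m ih =>
    intro X hX φ
    rw [Function.iterate_succ_apply'] at hX
    set μ := (Order.succ)^[m] κ with hμ_def
    have hκμ : κ ≤ μ := Cardinal.le_iterate_succ κ m
    have hμ : ℵ₀ ≤ μ := hκ.trans hκμ
    have hμX : μ < #X := Order.succ_le_iff.1 hX
    obtain ⟨j⟩ : Nonempty (μ.out ↪ X) := by
      rw [← mk_out μ] at hμX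
      exact hμX.le
    choose g c hg hc using fun x : X => ih (mk_out μ).ge fun y : Fin m → μ.out =>
      φ (Fin.cons x fun i => j (y i))
    have hcard : #((Fin m → Fin N → μ.out) × C) < #X := by
      refine lt_of_le_of_lt ?_ hμX
      have h1 : #(Fin m → Fin N → μ.out) = (μ ^ N) ^ m := by simp
      rw [mk_prod, lift_id, lift_id, h1]
      refine (mul_le_mul' ?_ (hC.trans hκμ)).trans (mul_eq_self hμ).le
      exact (pow_le_pow_left' (power_nat_le hμ) m).trans (power_nat_le hμ)
    have : Infinite X := infinite_iff.2 (hμ.trans hμX.le)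
    obtain ⟨⟨g₀, c₀⟩, hinf⟩ := exists_infinite_fiber (fun x => (g x, c x)) hcard
    obtain ⟨a⟩ : Nonempty (Fin N ↪ ((fun x => (g x, c x)) ⁻¹' {(g₀, c₀)} : Set X)) :=
      ⟨Fin.valEmbedding.trans (Infinite.natEmbedding _)⟩
    have ha : ∀ q, g (a q) = g₀ ∧ c (a q) = c₀ := fun q => Prod.mk.inj (a q).2
    refine ⟨Fin.cons (fun q => a q) fun i q => j (g₀ i q), c₀, ?_, fun p => ?_⟩
    · intro i
      refine Fin.cases ?_ (fun i => ?_) i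
      · exact Subtype.val_injective.comp a.injective
      · intro q q' hq
        have hinj := hg (a q) i
        rw [(ha q).1] at hinj
        exact hinj (j.injective hq)
    · have := hc (a (p 0)) fun i => p i.succ
      rw [(ha (p 0)).1, (ha (p 0)).2] at this
      refine Eq.trans (congrArg φ ?_) this
      funext i
      refine Fin.cases ?_ (fun i => ?_) i <;> rfl

theorem mem_fimg {V W : Type*} {g : V → W} {e : Finset V} {y : W} :
    y ∈ fimg g e ↔ ∃ x ∈ e, g x = y :=
  @Finset.mem_image _ _ (Classical.decEq W) _ _ _

theorem image_mem_LEdges {d k : ℕ} {α : Type v} {X : Type u} {P : Finset (Fin d → α)}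
    (hP : P.card = k) (G : Fin d → α → X)
    (hG : Set.InjOn (fun (x : Fin d → α) i => G i (x i)) P) :
    fimg (fun x i => G i (x i)) P ∈ LEdges k P X := by
  let _ := Classical.decEq (Fin d → X)
  refine ⟨(Finset.card_image_of_injOn hG).trans hP, fun x i => G i (x i), ?_, ?_, ?_⟩
  · exact fun x hx => mem_fimg.2 ⟨x, hx, rfl⟩
  · exact fun y hy => mem_fimg.1 hy
  · exact fun x _ y _ i hxy => congrArg (G i) hxy

theorem not_proper_of_constant_on_image {d k : ℕ} {α : Type v} {X C : Type u}
    {P : Finset (Fin d → α)} (hP : P.card = k) (φ : (Fin d → X) → C) (G : Fin d → α → X)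
    (hG : Set.InjOn (fun (x : Fin d → α) i => G i (x i)) P) (c : C)
    (hc : ∀ x ∈ P, φ (fun i => G i (x i)) = c) :
    ¬ ∀ e ∈ LEdges k P X, ∃ x ∈ e, ∃ y ∈ e, φ x ≠ φ y := by
  intro h
  obtain ⟨x, hx, y, hy, hxy⟩ := h _ (image_mem_LEdges hP G hG)
  obtain ⟨x', hx', rfl⟩ := mem_fimg.1 hx
  obtain ⟨y', hy', rfl⟩ := mem_fimg.1 hy
  exact hxy ((hc x' hx').trans (hc y' hy').symm)

theorem exists_distinguisher_card_eq_eT {d : ℕ} {α : Type v} (P : Finset (Fin d → α)) :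
    ∃ I : Finset (Fin d), IsDistinguisher P I ∧ I.card = eT P :=
  Nat.sInf_mem (s := {e | ∃ I : Finset (Fin d), IsDistinguisher P I ∧ I.card = e})
    ⟨_, Finset.univ, fun _ _ _ _ hxy => by simpa using Function.ne_iff.1 hxy, rfl⟩

theorem eT_le_card {d : ℕ} {α : Type v} {P : Finset (Fin d → α)} {I : Finset (Fin d)}
    (hI : IsDistinguisher P I) : eT P ≤ I.card :=
  Nat.sInf_le ⟨I, hI, rfl⟩

theorem eT_pos {d : ℕ} {α : Type v} {P : Finset (Fin d → α)} (hP : 2 ≤ P.card) : 0 < eT P := by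
  obtain ⟨I, hI, hcard⟩ := exists_distinguisher_card_eq_eT P
  rw [← hcard, Finset.card_pos]
  obtain ⟨x, hx, y, hy, hxy⟩ := Finset.one_lt_card.1 hP
  obtain ⟨i, hi, -⟩ := hI x hx y hy hxy
  exact ⟨i, hi⟩

theorem finite_coordinate_values {d : ℕ} {α : Type v} (P : Finset (Fin d → α)) :
    {a | ∃ x ∈ P, ∃ i, x i = a}.Finite := by
  have : {a | ∃ x ∈ P, ∃ i, x i = a} = ⋃ x ∈ P, Set.range x := by
    ext a
    simp
  rw [this]
  exact P.finite_toSet.biUnion fun x _ => Set.finite_range x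

theorem not_properlyColorable_of_lt_aleph0 {d k : ℕ} {α : Type v} {X : Type u} [Infinite X]
    {P : Finset (Fin d → α)} (hP : P.card = k) {κ : Cardinal.{u}} (hκ : κ < ℵ₀) :
    ¬ ProperlyColorable (LEdges k P X) κ := by
  classical
  rintro ⟨C, φ, hC, hφ⟩
  have : Finite C := lt_aleph0_iff_finite.1 (hC.trans_lt hκ)
  obtain ⟨N, w, hw⟩ := (finite_coordinate_values P).exists_injOn_fin
  let r := Infinite.natEmbedding X
  obtain ⟨a, ha, b, c, hc⟩ := Combinatorics.exists_mono_homothetic_copy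
    (P.image fun x i => (w (x i) : ℕ)) fun y : Fin d → ℕ => φ fun i => r (y i)
  refine not_proper_of_constant_on_image hP φ (fun i z => r (a * (w z : ℕ) + b i)) ?_ c ?_ hφ
  · intro x hx y hy hxy
    funext i
    have := r.injective (congrFun hxy i)
    exact hw ⟨x, hx, i, rfl⟩ ⟨y, hy, i, rfl⟩
      (Fin.ext (Nat.eq_of_mul_eq_mul_left ha (Nat.add_right_cancel this)))
  · exact fun x hx => hc _ (Finset.mem_image_of_mem _ hx)

theorem le_iterate_succ_of_properlyColorable {d k : ℕ} (hk : 2 ≤ k) {α : Type v} {X : Type u}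
    [Infinite X] {P : Finset (Fin d → α)} (hP : P.card = k) {κ : Cardinal.{u}}
    (h : ProperlyColorable (LEdges k P X) κ) : #X ≤ (Order.succ)^[eT P - 1] κ := by
  classical
  rcases lt_or_ge κ ℵ₀ with hκ | hκ
  · exact absurd h (not_properlyColorable_of_lt_aleph0 hP hκ)
  by_contra! hlt
  obtain ⟨C, φ, hC, hφ⟩ := h
  have hX : (Order.succ)^[eT P] κ ≤ #X := by
    rw [← Nat.sub_add_cancel (eT_pos (hk.trans hP.ge)), Function.iterate_succ_apply']
    exact Order.succ_le_of_lt hlt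
  obtain ⟨I, hI, hcard⟩ := exists_distinguisher_card_eq_eT P
  let σ : I ≃ Fin (eT P) := I.equivFinOfCardEq hcard
  obtain ⟨N, w, hw⟩ := (finite_coordinate_values P).exists_injOn_fin
  obtain ⟨z⟩ : Nonempty X := inferInstance
  obtain ⟨g, c, hg, hc⟩ := exists_monochromatic_grid hκ N (eT P) hC hX fun y =>
    φ fun i => if hi : i ∈ I then y (σ ⟨i, hi⟩) else z
  refine not_proper_of_constant_on_image hP φ
    (fun i a => if hi : i ∈ I then g (σ ⟨i, hi⟩) (w a) else z) ?_ c ?_ hφ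
  · intro x hx y hy hxy
    by_contra hne
    obtain ⟨i, hi, hxi⟩ := hI x hx y hy hne
    have := congrFun hxy i
    simp only [hi, dite_true] at this
    exact hxi (hw ⟨x, hx, i, rfl⟩ ⟨y, hy, i, rfl⟩ (hg _ this))
  · intro x _
    rw [← hc fun l => w (x (σ.symm l))]
    simp

theorem properlyColorable_of_le_iterate_succ {d k : ℕ} (hk : 2 ≤ k) {α : Type v} {X : Type u}
    [Infinite X] {P : Finset (Fin d → α)} (hP : P.card = k) {κ : Cardinal.{u}}
    (h : #X ≤ (Order.succ)^[eT P - 1] κ) : ProperlyColorable (LEdges k P X) κ := by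
  classical
  have hκ : ℵ₀ ≤ κ := by
    by_contra! hκ
    exact (h.trans_lt (Cardinal.iterate_succ_lt_aleph0 hκ _)).not_ge (aleph0_le_mk X)
  obtain ⟨C, φ, hC, hφ⟩ := exists_coloring_distinguished d hκ (eT P - 1) h
  refine ⟨C, φ, hC, ?_⟩
  rintro Q ⟨hQ, f, hfQ, hfsurj, hf⟩
  by_contra! hconst
  obtain ⟨q, hq⟩ : Q.Nonempty := Finset.card_pos.1 (by omega)
  obtain ⟨I, hIcard, hI⟩ := hφ (φ q)
  have hinj : Set.InjOn f P :=
    Finset.injOn_of_surjOn_of_card_le f hfQ hfsurj (hP.trans hQ.symm).le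
  have hdist : IsDistinguisher P I := by
    intro x hx y hy hxy
    by_contra! hIxy
    exact hxy (hinj hx hy (hI _ _ (hconst _ (hfQ x hx) q hq) (hconst _ (hfQ y hy) q hq)
      fun i hi => hf x hx y hy i (hIxy i hi)))
  have := eT_le_card hdist
  have := eT_pos (hk.trans hP.ge)
  omega

theorem properlyColorable_chromaticNumber {V : Type u} {E : Set (Finset V)} {κ : Cardinal.{u}}
    (h : ProperlyColorable E κ) : ProperlyColorable E (chromaticNumber E) :=
  csInf_mem (s := {κ | ProperlyColorable E κ}) ⟨κ, h⟩

/-- If `P` is a `d`-dimensional `k`-template and `X` is an infinite set, then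
`χ(L(X^d,P))` is the least cardinal `κ` such that `κ⁺⁽ᵉ⁽ᴾ⁾⁻¹⁾ ≥ |X|`. -/
theorem chromaticNumber_template_hypergraph {α : Type v} {X : Type u} [Infinite X]
    (d k : ℕ) (hk : 2 ≤ k) (P : Finset (Fin d → α)) (hP : P.card = k) :
    IsLeast {κ : Cardinal.{u} | #X ≤ (Order.succ)^[eT P - 1] κ}
      (chromaticNumber (LEdges k P X)) := by
  have hcol : ProperlyColorable (LEdges k P X) (#X) :=
    properlyColorable_of_le_iterate_succ hk hP (Cardinal.le_iterate_succ _ _)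
  exact ⟨le_iterate_succ_of_properlyColorable hk hP (properlyColorable_chromaticNumber hcol),
    fun κ hκ => csInf_le' (properlyColorable_of_le_iterate_succ hk hP hκ)⟩
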